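/- Let q = p^h with p an odd prime, 2e ∣ h, and n = t p^{h-e} with 1 ≤ t ≤ p^e. Then for any 1 ≤ k ≤ ⌊(p^e + n - 1)/(p^e + 1)⌋ and 0 ≤ l ≤ k - 1, there exists an [n+1, k] MDS code C over F_q with dim Hull_e(C) = l. -/

import Mathlib

/-- The `e`-Galois dual relative to the inner product `⟨x, y⟩ = ∑ i, x i * (y i)^pe`. -/
def galoisDual {F : Type*} [Field F] {ι : Type*} [Fintype ι] (pe : ℕ)
    (C : Submodule F (ι → F)) : Submodule F (ι → F) where
  carrier := {x | ∀ y ∈ C, ∑ i, x i * (y i) ^ pe = 0}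
  add_mem' := by
    intro x y hx hy z hz
    simp only [Pi.add_apply, add_mul, Finset.sum_add_distrib]
    rw [hx z hz, hy z hz, add_zero]
  zero_mem' := by
    intro y _
    simp
  smul_mem' := by
    intro c x hx y hy
    simp only [Pi.smul_apply, smul_eq_mul, mul_assoc, ← Finset.mul_sum]
    rw [hx y hy, mul_zero]

section Helpers
open Polynomial

/-- Extended generalized Reed-Solomon encoder. -/
noncomputable def egrs {F : Type*} [Field F] (k n : ℕ) (a v : Fin n → F) :
    degreeLT F k →ₗ[F] (Fin (n + 1) → F) where
  toFun f := Fin.cons ((f : F[X]).coeff (k - 1)) (fun i => v i * (f : F[X]).eval (a i))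
  map_add' f g := by
    funext i
    refine Fin.cases ?_ (fun i => ?_) i <;> simp [mul_add]
  map_smul' c f := by
    funext i
    refine Fin.cases ?_ (fun i => ?_) i
    · simp
    · simp; ring

theorem egrs_zero {F : Type*} [Field F] (k n : ℕ) (a v : Fin n → F) (f : degreeLT F k) :
    egrs k n a v f 0 = (f : F[X]).coeff (k - 1) := rfl

theorem egrs_succ {F : Type*} [Field F] (k n : ℕ) (a v : Fin n → F) (f : degreeLT F k)
    (i : Fin n) : egrs k n a v f i.succ = v i * (f : F[X]).eval (a i) := rfl

theorem natDegree_lt_of_degreeLT {F : Type*} [Field F] {k : ℕ} (hk : 1 ≤ k) (f : degreeLT F k) :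
    (f : F[X]).natDegree < k := by
  have := mem_degreeLT.1 f.2
  by_cases h0 : (f : F[X]) = 0
  · rw [h0]; simp; omega
  · exact (natDegree_lt_iff_degree_lt h0).2 this

theorem egrs_weight {F : Type*} [Field F] [DecidableEq F] (k n : ℕ) (hk : 1 ≤ k) (hkn : k ≤ n)
    (a v : Fin n → F) (ha : Function.Injective a) (hv : ∀ i, v i ≠ 0)
    (f : degreeLT F k) (hf : f ≠ 0) : n - k + 2 ≤ hammingNorm (egrs k n a v f) := by
  have hf0 : (f : F[X]) ≠ 0 := by simpa using hf
  have hd := natDegree_lt_of_degreeLT hk f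
  have hz : (Finset.univ.filter fun i : Fin n => (f : F[X]).eval (a i) = 0).card
      ≤ (f : F[X]).natDegree := by
    have : ((Finset.univ.filter fun i : Fin n => (f : F[X]).eval (a i) = 0).image a).val
        ⊆ (f : F[X]).roots := by
      intro x hx
      simp only [Finset.mem_val, Finset.mem_image, Finset.mem_filter, Finset.mem_univ, true_and] at hx
      obtain ⟨i, hi, rfl⟩ := hx
      rw [mem_roots hf0]; exact hi
    have h2 := card_le_degree_of_subset_roots this
    rwa [Finset.card_image_of_injective _ ha] at h2
  have hs := Finset.card_filter_add_card_filter_not (s := (Finset.univ : Finset (Fin n)))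
    (fun i : Fin n => (f : F[X]).eval (a i) = 0)
  rw [Finset.card_univ, Fintype.card_fin] at hs
  have hn : hammingNorm (egrs k n a v f) = (if (f : F[X]).coeff (k - 1) ≠ 0 then 1 else 0) +
      (Finset.univ.filter fun i : Fin n => ¬ (f : F[X]).eval (a i) = 0).card := by
    unfold hammingNorm
    rw [Fin.card_filter_univ_succ]
    simp only [egrs_zero, egrs_succ, mul_ne_zero_iff, hv, ne_eq,
      not_false_eq_true, true_and]
    split_ifs <;> omega
  rw [hn]
  split_ifs with hc
  · omega
  · have : (f : F[X]).natDegree ≠ k - 1 := by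
      intro h
      rw [← h] at hc
      exact hc (by simpa using hf0)
    omega

theorem egrs_surjective {F : Type*} [Field F] (k s : ℕ) (hsk : s + 1 ≤ k)
    (a : Fin s → F) (ha : Function.Injective a) :
    Function.Surjective (egrs k s a (fun _ => 1)) := by
  classical
  intro y
  set N := Lagrange.nodal Finset.univ a with hN
  have hNd : N.natDegree = s := by simp [hN, Lagrange.natDegree_nodal]
  have hNm : N.Monic := Lagrange.nodal_monic
  set I := Lagrange.interpolate Finset.univ a (fun i => y i.succ) with hI
  have hId : I.degree < s := by
    have := Lagrange.degree_interpolate_lt (s := Finset.univ) (v := a)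
      (fun i => y i.succ) ha.injOn
    rwa [Finset.card_univ, Fintype.card_fin] at this
  have hMm : (N * X ^ (k - 1 - s)).Monic := hNm.mul (monic_X_pow _)
  have hMd : (N * X ^ (k - 1 - s)).natDegree = k - 1 := by
    rw [hNm.natDegree_mul (monic_X_pow _), hNd, natDegree_X_pow]; omega
  refine ⟨⟨I + C (y 0) * (N * X ^ (k - 1 - s)), ?_⟩, ?_⟩
  · refine Submodule.add_mem _ ?_ ?_
    · rw [mem_degreeLT]
      exact hId.trans_le (by exact_mod_cast (by omega))
    · rw [← smul_eq_C_mul]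
      refine Submodule.smul_mem _ _ ?_
      rw [mem_degreeLT, degree_eq_natDegree hMm.ne_zero, hMd]
      exact_mod_cast (by omega)
  · funext i
    refine Fin.cases ?_ (fun i => ?_) i
    · rw [egrs_zero]
      have h1 : I.coeff (k - 1) = 0 :=
        coeff_eq_zero_of_degree_lt (hId.trans_le (by exact_mod_cast (by omega)))
      have h2 : (N * X ^ (k - 1 - s)).coeff (k - 1) = 1 := by
        have := hMm.coeff_natDegree
        rwa [hMd] at this
      simp only [coeff_add, coeff_C_mul, h1, h2]; ring
    · rw [egrs_succ]
      have h1 : I.eval (a i) = y i.succ :=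
        Lagrange.eval_interpolate_at_node (fun i : Fin s => y i.succ) ha.injOn (Finset.mem_univ i)
      have h2 : N.eval (a i) = 0 := Lagrange.eval_nodal_at_node (Finset.mem_univ i)
      simp [h1, h2]

theorem code_part {F : Type*} [Field F] [DecidableEq F] (k n s Q : ℕ) (hsk : s + 1 ≤ k)
    (hkn : k ≤ n) (hQ : Q ≠ 0) (hb : (k - 1) * (Q + 1) + 2 ≤ n)
    (a v w : Fin n → F) (ha : Function.Injective a) (hv : ∀ i, v i ≠ 0)
    (hw : ∀ P : F[X], P.natDegree + 2 ≤ n → ∑ i, w i * P.eval (a i) = 0)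
    (hvw : ∀ i : Fin n, v i ^ (Q + 1) = w i ↔ s ≤ i.val) :
    ∃ C : Submodule F (Fin (n + 1) → F),
      Module.finrank F C = k ∧
      (∀ c ∈ C, c ≠ 0 → n - k + 2 ≤ hammingNorm c) ∧
      Module.finrank F ↥(C ⊓ galoisDual Q C) = k - 1 - s := by
  have hk : 1 ≤ k := by omega
  have hsn : s ≤ n := by omega
  have hfr : Module.finrank F (degreeLT F k) = k := by
    rw [(degreeLTEquiv F k).finrank_eq]; simp
  have : FiniteDimensional F (degreeLT F k) := (degreeLTEquiv F k).symm.finiteDimensional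
  have hinj : Function.Injective (egrs k n a v) := by
    rw [← LinearMap.ker_eq_bot, LinearMap.ker_eq_bot']
    intro f hf
    by_contra h0
    have := egrs_weight k n hk hkn a v ha hv f h0
    rw [hf, hammingNorm_zero] at this
    omega
  set E := egrs k s (fun i => a (Fin.castLE hsn i)) (fun _ => 1) with hE
  have hEs : Function.Surjective E := egrs_surjective k s hsk _
    (ha.comp (Fin.castLE_injective hsn))
  refine ⟨LinearMap.range (egrs k n a v), ?_, ?_, ?_⟩
  · rw [LinearMap.finrank_range_of_inj hinj, hfr]
  · rintro _ ⟨f, rfl⟩ h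
    exact egrs_weight k n hk hkn a v ha hv f (fun h0 => h (by rw [h0, map_zero]))
  · rw [← Submodule.map_comap_eq, 
      ← LinearEquiv.finrank_eq (Submodule.equivMapOfInjective _ hinj _)]
    have key : ∀ f g : degreeLT F k,
        ∑ i, egrs k n a v f i * (egrs k n a v g i) ^ Q =
          (f : F[X]).coeff (k - 1) * ((g : F[X]).coeff (k - 1)) ^ Q +
          ∑ i, (v i ^ (Q + 1) - w i) * ((f : F[X]).eval (a i) * (g : F[X]).eval (a i) ^ Q) := by
      intro f g
      rw [Fin.sum_univ_succ]
      simp only [egrs_zero, egrs_succ]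
      have h := hw ((f : F[X]) * (g : F[X]) ^ Q) (by
        have h1 := natDegree_lt_of_degreeLT hk f
        have h2 := natDegree_lt_of_degreeLT hk g
        have h3 : ((f : F[X]) * (g : F[X]) ^ Q).natDegree ≤ (k - 1) + Q * (k - 1) := by
          refine natDegree_mul_le.trans (add_le_add (by omega) (natDegree_pow_le.trans ?_))
          exact Nat.mul_le_mul_left _ (by omega)
        have h4 : (k - 1) * (Q + 1) = (k - 1) + Q * (k - 1) := by ring
        omega)
      congr 1
      rw [← sub_zero (∑ i, v i * _ * _), ← h, ← Finset.sum_sub_distrib]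
      refine Finset.sum_congr rfl fun i _ => ?_
      rw [eval_mul, eval_pow]; ring
    have hker : Submodule.comap (egrs k n a v) (galoisDual Q (LinearMap.range (egrs k n a v)))
        = LinearMap.ker E := by
      ext f
      rw [LinearMap.mem_ker, Submodule.mem_comap]
      have hmem : egrs k n a v f ∈ galoisDual Q (LinearMap.range (egrs k n a v)) ↔
          ∀ g, ∑ i, egrs k n a v f i * (egrs k n a v g i) ^ Q = 0 := by
        constructor
        · intro h g
          exact h _ ⟨g, rfl⟩
        · rintro h _ ⟨g, rfl⟩
          exact h g
      rw [hmem]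
      simp only [key]
      constructor
      · intro h
        funext j
        obtain ⟨g, hg⟩ := hEs (Pi.single j 1)
        have hg0 : (g : F[X]).coeff (k - 1) = (Pi.single j 1 : Fin (s + 1) → F) 0 := by
          rw [← hg]; rfl
        have hgi : ∀ i (hi : i < s), (g : F[X]).eval (a ⟨i, by omega⟩) =
            (Pi.single j 1 : Fin (s + 1) → F) (Fin.succ ⟨i, hi⟩) := by
          intro i hi
          rw [← hg, hE, egrs_succ, one_mul]; rfl
        have h := h g
        revert hg0 hgi
        refine Fin.cases ?_ (fun j => ?_) j
        · intro hg0 hgi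
          rw [hE, egrs_zero]
          rw [hg0, Finset.sum_eq_zero] at h
          · simpa using h
          · intro i _
            by_cases his : i.val < s
            · have := hgi i.val his
              rw [Pi.single_eq_of_ne (Fin.succ_ne_zero _)] at this
              rw [show (⟨i.val, by omega⟩ : Fin n) = i from rfl] at this
              rw [this, zero_pow hQ]; ring
            · rw [(hvw i).2 (by omega)]; ring
        · intro hg0 hgi
          rw [hE, egrs_succ, one_mul]
          rw [hg0, Pi.single_eq_of_ne (Fin.succ_ne_zero _).symm, zero_pow hQ, mul_zero, zero_add,
            Finset.sum_eq_single (Fin.castLE hsn j)] at h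
          · have h1 := hgi j.val j.2
            rw [Pi.single_eq_same] at h1
            rw [show (⟨j.val, by omega⟩ : Fin n) = Fin.castLE hsn j from rfl] at h1
            rw [h1, one_pow, mul_one] at h
            rcases mul_eq_zero.1 h with h | h
            · have := (hvw _).1 (sub_eq_zero.1 h)
              have := j.2
              simp at *
              omega
            · exact h
          · intro i _ hij
            by_cases his : i.val < s
            · have := hgi i.val his
              rw [Pi.single_eq_of_ne] at this
              · rw [show (⟨i.val, by omega⟩ : Fin n) = i from rfl] at this
                rw [this, zero_pow hQ]; ring
              · intro hh
                apply hij
                have := congrArg Fin.val (Fin.succ_injective _ hh)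
                exact Fin.ext this
            · rw [(hvw i).2 (by omega)]; ring
          · simp
      · intro h g
        have h0 : (f : F[X]).coeff (k - 1) = 0 := congrFun h 0
        rw [h0, zero_mul, zero_add]
        refine Finset.sum_eq_zero fun i _ => ?_
        by_cases his : i.val < s
        · have := congrFun h (Fin.succ ⟨i.val, his⟩)
          rw [hE, egrs_succ, one_mul] at this
          have h2 : (f : F[X]).eval (a i) = 0 := this
          rw [h2]; ring
        · rw [(hvw i).2 (by omega)]; ring
    rw [hker]
    have := LinearMap.finrank_range_add_finrank_ker E
    rw [LinearMap.range_eq_top.2 hEs, finrank_top, hfr] at this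
    simp at this
    omega

theorem exists_root_pow {F : Type*} [Field F] [Fintype F] (d m : ℕ) (hm : m ≠ 0)
    (hq : Fintype.card F - 1 = d * m) (u : F) (hu : u ≠ 0) (hum : u ^ m = 1) :
    ∃ v : F, v ≠ 0 ∧ v ^ d = u := by
  classical
  obtain ⟨g, hg⟩ := IsCyclic.exists_generator (α := Fˣ)
  obtain ⟨j, hj⟩ := Submonoid.mem_powers_iff _ _ |>.1 
    ((mem_powers_iff_mem_zpowers).2 (hg (Units.mk0 u hu)))
  have ho : orderOf g = d * m := by
    rw [orderOf_eq_card_of_forall_mem_zpowers hg, Nat.card_eq_fintype_card, Fintype.card_units, hq]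
  have h1 : g ^ (j * m) = 1 := by
    rw [pow_mul, hj]; ext; simpa using hum
  have h2 : d * m ∣ j * m := ho ▸ orderOf_dvd_of_pow_eq_one h1
  obtain ⟨c, rfl⟩ := Nat.dvd_of_mul_dvd_mul_right (Nat.pos_of_ne_zero hm) h2
  refine ⟨((g ^ c : Fˣ) : F), Units.ne_zero _, ?_⟩
  have := congrArg Units.val hj
  simp only [Units.val_mk0] at this
  rw [← this, ← Units.val_pow_eq_pow_val, ← pow_mul, mul_comm]

theorem exists_enum {F : Type*} [Field F] [Fintype F] (f : F[X]) (hf : f.Monic) (N : ℕ)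
    (hN : f.natDegree = N)
    (hd : f ∣ X ^ Fintype.card F - X) :
    ∃ a : Fin N → F, Function.Injective a ∧
      f = Lagrange.nodal Finset.univ a := by
  classical
  have h0 : (X ^ Fintype.card F - X : F[X]) ≠ 0 :=
    FiniteField.X_pow_card_sub_X_ne_zero F Fintype.one_lt_card
  have hs : (X ^ Fintype.card F - X : F[X]).Splits := by
    rw [splits_iff_card_roots, FiniteField.roots_X_pow_card_sub_X,
      FiniteField.X_pow_card_sub_X_natDegree_eq F Fintype.one_lt_card]
    simp
  have hfs : f.Splits := hs.of_dvd h0 hd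
  have hle := roots.le_of_dvd h0 hd
  have hnd : f.roots.Nodup := by
    refine Multiset.nodup_of_le hle ?_
    rw [FiniteField.roots_X_pow_card_sub_X]
    exact Finset.univ.nodup
  have hc : f.roots.toFinset.card = N := by
    rw [Multiset.toFinset_card_of_nodup hnd, ← hfs.natDegree_eq_card_roots, hN]
  let ε := f.roots.toFinset.equivFinOfCardEq hc
  refine ⟨fun i => (ε.symm i : F), fun i j hij => ε.symm.injective (Subtype.ext hij), ?_⟩
  rw [Lagrange.nodal]
  rw [Equiv.prod_comp ε.symm (fun x : f.roots.toFinset => (X - C (x : F)))]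
  rw [Finset.prod_coe_sort f.roots.toFinset (fun x => X - C x)]
  conv_lhs => rw [hfs.eq_prod_roots_of_monic hf]
  rw [Finset.prod, Multiset.toFinset_val, hnd.dedup]

theorem points_part (p h e t n : ℕ)
    (hp : p.Prime) (he : 0 < e) (hdvd : 2 * e ∣ h)
    (ht1 : 1 ≤ t) (ht2 : t ≤ p ^ e) (hn : n = t * p ^ (h - e))
    (F : Type*) [Field F] [Fintype F] [CharP F p]
    (hcard : Fintype.card F = p ^ h) :
    ∃ a v : Fin n → F, Function.Injective a ∧ (∀ i, v i ≠ 0) ∧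
      ∀ P : F[X], P.natDegree + 2 ≤ n → ∑ i, v i ^ (p ^ e + 1) * P.eval (a i) = 0 := by
  classical
  have : Fact p.Prime := ⟨hp⟩
  have : ExpChar F p := ExpChar.prime hp
  obtain ⟨m, hm⟩ := hdvd
  have hm0 : m ≠ 0 := by
    rintro rfl
    have := Fintype.one_lt_card (α := F)
    rw [hcard, hm] at this
    simp at this
  set Q := p ^ e with hQ
  have hQ1 : 1 < Q := Nat.one_lt_pow he.ne' hp.one_lt
  have hq : Fintype.card F = Q ^ (2 * m) := by
    rw [hcard, hm, hQ, ← pow_mul]; congr 1; ring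
  have hpQ : ∀ i, p ^ (e * i) = Q ^ i := fun i => by rw [hQ, pow_mul]
  have subQ : ∀ (x y : F[X]) (i : ℕ), (x - y) ^ (Q ^ i) = x ^ (Q ^ i) - y ^ (Q ^ i) := by
    intro x y i
    rw [← hpQ]; exact sub_pow_expChar_pow x y _
  -- trace polynomial
  set L : F[X] := ∑ i ∈ Finset.range (2 * m), X ^ (Q ^ i) with hL
  have hXq : ∀ r, ∑ i ∈ Finset.range r, (X ^ Q - X : F[X]) ^ (Q ^ i) = X ^ (Q ^ r) - X := by
    intro r
    have : ∀ i, (X ^ Q - X : F[X]) ^ (Q ^ i) = X ^ (Q ^ (i + 1)) - X ^ (Q ^ i) := by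
      intro i
      rw [subQ, ← pow_mul, pow_succ']
    simp only [this]
    rw [Finset.sum_range_sub (fun i => (X : F[X]) ^ (Q ^ i))]; simp
  have hLQ : L ^ Q - L = X ^ Fintype.card F - X := by
    have h1 : L ^ Q = ∑ i ∈ Finset.range (2 * m), X ^ (Q ^ (i + 1)) := by
      rw [hL, hQ, sum_pow_char_pow]
      refine Finset.sum_congr rfl fun i _ => ?_
      rw [← pow_mul, pow_succ]
    rw [h1, hL, ← Finset.sum_sub_distrib, Finset.sum_range_sub (fun i => (X : F[X]) ^ (Q ^ i)), hq]; simp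
  have hdq : (X ^ Q - X : F[X]) ∣ X ^ Fintype.card F - X := by
    rw [hq, ← hXq]
    exact Finset.dvd_sum fun i _ => dvd_pow_self _ (by positivity)
  have hXm : (X ^ Q - X : F[X]).Monic := by
    apply monic_X_pow_sub; rw [degree_X]; exact_mod_cast hQ1
  have hQd : (X ^ Q - X : F[X]).natDegree = Q :=
    FiniteField.X_pow_card_sub_X_natDegree_eq F hQ1
  obtain ⟨b, hbinj, hb⟩ := exists_enum _ hXm Q hQd hdq
  obtain ⟨S, -, hS⟩ := Finset.exists_subset_card_eq (s := (Finset.univ : Finset (Fin Q))) (n := t)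
    (by simpa using ht2)
  have hbQ : ∀ i, b i ^ Q = b i := by
    intro i
    have := Lagrange.eval_nodal_at_node (s := Finset.univ) (v := b) (Finset.mem_univ i)
    rw [← hb] at this
    simpa [sub_eq_zero] using this
  set g := Lagrange.nodal S b with hg
  have hgm : g.Monic := Lagrange.nodal_monic
  have hgd : g.natDegree = t := by rw [hg, Lagrange.natDegree_nodal, hS]
  have hgX : g ∣ X ^ Q - X := by
    rw [hb]; exact Finset.prod_dvd_prod_of_subset _ _ _ (Finset.subset_univ _)
  -- degree of L
  obtain ⟨r, hr⟩ : ∃ r, 2 * m = r + 1 := ⟨2 * m - 1, by omega⟩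
  have hLow : (∑ i ∈ Finset.range r, (X : F[X]) ^ (Q ^ i)).degree < (Q ^ r : ℕ) := by
    rw [← mem_degreeLT]
    refine Submodule.sum_mem _ fun i hi => ?_
    rw [mem_degreeLT, degree_X_pow]
    exact_mod_cast Nat.pow_lt_pow_right hQ1 (Finset.mem_range.1 hi)
  have hL2 : L = X ^ (Q ^ r) + ∑ i ∈ Finset.range r, (X : F[X]) ^ (Q ^ i) := by
    rw [hL, hr, Finset.sum_range_succ, add_comm]
  have hLm : L.Monic := by rw [hL2]; exact monic_X_pow_add hLow
  have hLd : L.natDegree = Q ^ r := by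
    rw [hL2]
    apply natDegree_eq_of_degree_eq_some
    rw [degree_add_eq_left_of_degree_lt (by rwa [degree_X_pow]), degree_X_pow]
  have hfm : (g.comp L).Monic := hgm.comp hLm (by rw [hLd]; positivity)
  have hfd : (g.comp L).natDegree = n := by
    rw [natDegree_comp, hgd, hLd, hn, ← hpQ]
    congr 2
    rw [hm, show 2 * e * m = e * (2 * m) by ring, hr, mul_add]; omega
  have hfdvd : g.comp L ∣ X ^ Fintype.card F - X := by
    rw [← hLQ]
    obtain ⟨c, hc⟩ := hgX
    refine ⟨c.comp L, ?_⟩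
    rw [← mul_comp, ← hc]; simp
  obtain ⟨a, hainj, hfa⟩ := exists_enum _ hfm n hfd hfdvd
  -- derivative
  have hLder : derivative L = 1 := by
    rw [hL, hr, Finset.sum_range_succ', derivative_add, derivative_sum, Finset.sum_eq_zero]
    · simp
    · intro i _
      rw [derivative_X_pow, ← hpQ]
      have : ((p ^ (e * (i + 1)) : ℕ) : F) = 0 := by
        rw [Nat.cast_pow, CharP.cast_eq_zero, zero_pow]
        positivity
      rw [this]; simp
  have hder : ∀ x : F, eval x (derivative (g.comp L)) = eval (eval x L) (derivative g) := by
    intro x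
    rw [derivative_comp, hLder]; simp [eval_comp]
  set σ := iterateFrobenius F p e with hσ
  have hσa : ∀ x, σ x = x ^ Q := fun x => iterateFrobenius_def p e x
  have hgσ : g.map σ = g := by
    rw [hg, Lagrange.nodal, Polynomial.map_prod]
    refine Finset.prod_congr rfl fun i _ => ?_
    rw [Polynomial.map_sub, map_X, map_C, hσa, hbQ]
  have hLfix : ∀ x : F, (eval x L) ^ Q = eval x L := by
    intro x
    have := congrArg (eval x) hLQ
    simp only [eval_sub, eval_pow, eval_X, FiniteField.pow_card, sub_self] at this
    exact sub_eq_zero.1 this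
  have hdfix : ∀ x : F, (eval x (derivative (g.comp L))) ^ Q = eval x (derivative (g.comp L)) := by
    intro x
    rw [hder, ← hσa, ← Polynomial.eval_map_apply, ← derivative_map, hgσ, hσa, hLfix]
  have hw : ∀ i, ∃ v : F, v ≠ 0 ∧ v ^ (Q + 1) = Lagrange.nodalWeight Finset.univ a i := by
    intro i
    have hne : Lagrange.nodalWeight Finset.univ a i ≠ 0 :=
      Lagrange.nodalWeight_ne_zero hainj.injOn (Finset.mem_univ i)
    have hfix : Lagrange.nodalWeight Finset.univ a i ^ Q = Lagrange.nodalWeight Finset.univ a i := by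
      rw [Lagrange.nodalWeight_eq_eval_derivative_nodal (Finset.mem_univ i), ← hfa, inv_pow, hdfix]
    have h1 : Lagrange.nodalWeight Finset.univ a i ^ (Q - 1) = 1 := by
      apply mul_right_cancel₀ hne
      rw [← pow_succ, Nat.sub_add_cancel hQ1.le, hfix, one_mul]
    obtain ⟨c, hc⟩ : Q ^ 2 - 1 ∣ (Q ^ 2) ^ m - 1 := by
      simpa using Nat.sub_dvd_pow_sub_pow (Q ^ 2) 1 m
    have h2 : Q ^ 2 - 1 = (Q + 1) * (Q - 1) := by
      have := Nat.sq_sub_sq Q 1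
      simpa using this
    have h3 : Fintype.card F - 1 = (Q + 1) * ((Q - 1) * c) := by
      rw [hq, pow_mul, hc, h2, mul_assoc]
    refine exists_root_pow (Q + 1) ((Q - 1) * c) ?_ h3 _ hne ?_
    · intro h0
      rw [h0] at h3
      have := Fintype.one_lt_card (α := F)
      omega
    · rw [pow_mul, h1, one_pow]
  choose v hv0 hv using hw
  refine ⟨a, v, hainj, hv0, fun P hP => ?_⟩
  have hdeg : P.natDegree < n - 1 := by omega
  have hs := Lagrange.coeff_eq_sum (s := Finset.univ) (v := a) hainj.injOn (P := P) (by
    rw [Finset.card_univ, Fintype.card_fin]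
    exact degree_le_natDegree.trans_lt (by exact_mod_cast (by omega)))
  rw [Finset.card_univ, Fintype.card_fin, coeff_eq_zero_of_natDegree_lt hdeg] at hs
  rw [hs]
  refine Finset.sum_congr rfl fun i _ => ?_
  rw [hv, Lagrange.nodalWeight, Finset.prod_inv_distrib, div_eq_mul_inv, mul_comm]

theorem exists_alpha {F : Type*} [Field F] [Fintype F] (Q : ℕ) (hQ : 3 ≤ Q)
    (hc : Q ^ 2 ≤ Fintype.card F) : ∃ α : F, α ≠ 0 ∧ α ^ (Q + 1) ≠ 1 := by
  classical
  by_contra! hcon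
  have hsub : (Finset.univ.erase (0 : F)).val ⊆ (X ^ (Q + 1) - C 1 : F[X]).roots := by
    intro x hx
    rw [mem_roots (X_pow_sub_C_ne_zero (by omega) 1)]
    have hx0 : x ≠ 0 := (Finset.mem_erase.1 (show x ∈ Finset.univ.erase (0 : F) from hx)).1
    simp [hcon x hx0]
  have := card_le_degree_of_subset_roots hsub
  rw [natDegree_X_pow_sub_C, Finset.card_erase_of_mem (Finset.mem_univ _), Finset.card_univ] at this
  have : Q ^ 2 ≤ Q + 2 := by omega
  nlinarith

end Helpers

theorem exists_MDS_with_galois_hull_dim_trace (p h e t n k l : ℕ)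
    (hp : p.Prime) (hpodd : Odd p) (he : 0 < e) (hdvd : 2 * e ∣ h)
    (ht1 : 1 ≤ t) (ht2 : t ≤ p ^ e) (hn : n = t * p ^ (h - e))
    (F : Type*) [Field F] [Fintype F] [DecidableEq F] [CharP F p]
    (hcard : Fintype.card F = p ^ h)
    (hk1 : 1 ≤ k) (hk2 : k ≤ (p ^ e + n - 1) / (p ^ e + 1)) (hl : l ≤ k - 1) :
    ∃ C : Submodule F (Fin (n + 1) → F),
      Module.finrank F C = k ∧
      (∀ c ∈ C, c ≠ 0 → n - k + 2 ≤ hammingNorm c) ∧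
      Module.finrank F ↥(C ⊓ galoisDual (p ^ e) C) = l := by
  have hQ3 : 3 ≤ p ^ e := by
    have h3 : 3 ≤ p := by
      have := hp.two_le
      rcases hpodd with ⟨c, hc⟩
      omega
    exact h3.trans (Nat.le_self_pow he.ne' p)
  have hqQ : (p ^ e) ^ 2 ≤ Fintype.card F := by
    rw [hcard, ← pow_mul]
    apply Nat.pow_le_pow_right hp.pos
    have hh : h ≠ 0 := by
      rintro rfl
      have := Fintype.one_lt_card (α := F)
      rw [hcard] at this
      simp at this
    have := Nat.le_of_dvd (Nat.pos_of_ne_zero hh) hdvd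
    omega
  obtain ⟨a, v, ha, hv, hsum⟩ := points_part p h e t n hp he hdvd ht1 ht2 hn F hcard
  obtain ⟨α, hα0, hα⟩ := exists_alpha (F := F) (p ^ e) hQ3 hqQ
  have hk3 := (Nat.le_div_iff_mul_le (by omega)).1 hk2
  obtain ⟨k', rfl⟩ : ∃ k', k = k' + 1 := ⟨k - 1, by omega⟩
  have hb : k' * (p ^ e + 1) + 2 ≤ n := by
    have : (k' + 1) * (p ^ e + 1) = k' * (p ^ e + 1) + (p ^ e + 1) := by ring
    omega
  have hkn : k' + 1 ≤ n := by nlinarith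
  obtain ⟨C, h1, h2, h3⟩ := code_part (k' + 1) n (k' - l) (p ^ e) (by omega) hkn (by omega)
    (by simpa using hb) a (fun i => if i.val < k' - l then α * v i else v i)
    (fun i => v i ^ (p ^ e + 1)) ha
    (by
      intro i
      split_ifs
      · exact mul_ne_zero hα0 (hv i)
      · exact hv i) hsum
    (by
      intro i
      split_ifs with hi
      · rw [mul_pow]
        constructor
        · intro h
          exact absurd (mul_right_cancel₀ (pow_ne_zero _ (hv i)) (h.trans (one_mul _).symm)) hα
        · omega
      · simp; omega)
  refine ⟨C, h1, h2, ?_⟩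
  rw [h3]
  omega
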